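/- Assume the Generalized Riemann Hypothesis. Then there exists a constant c > 0 such that for infinitely many primes p, every prime q ≤ c·log p·log log p satisfies (q/p) = 1; equivalently, the least quadratic nonresidue modulo p is greater than c·log p·log log p. -/

import Mathlib

/-- The Generalized Riemann Hypothesis: every zero of a Dirichlet L-function in the
critical strip `0 < Re s < 1` has real part `1/2`. -/
def GRH : Prop :=
  ∀ (r : ℕ) [NeZero r] (χ : DirichletCharacter ℂ r) (s : ℂ),
    0 < s.re → s.re < 1 → DirichletCharacter.LFunction χ s = 0 → s.re = 1 / 2

open Complex Metric in
/-- **Borel–Carathéodory for logarithmic derivatives.** -/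
theorem norm_iteratedDeriv_logDeriv_le {F : ℂ → ℂ} {c : ℂ} {r R A : ℝ} (hr : 0 < r) (hrR : r < R)
    (hA : 0 < A) (hF : DifferentiableOn ℂ F (ball c R)) (h0 : ∀ z ∈ ball c R, F z ≠ 0)
    (hle : ∀ z ∈ ball c R, ‖F z‖ ≤ Real.exp A * ‖F c‖) (m : ℕ) :
    ‖iteratedDeriv m (fun z ↦ deriv F z / F z) c‖ ≤
      (m + 1).factorial * (2 * A * r / (R - r)) / r ^ (m + 1) := by
  have hR : 0 < R := hr.trans hrR
  have hc : c ∈ ball c R := mem_ball_self hR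
  obtain ⟨g, hgc, hg⟩ := ((hF.deriv isOpen_ball).div hF h0).isExactOn_ball.with_val_at c 0
  simp only [Pi.div_apply] at hg
  have hFd : ∀ z ∈ ball c R, HasDerivAt F (deriv F z) z := fun z hz ↦
    (hF.differentiableAt (isOpen_ball.mem_nhds hz)).hasDerivAt
  have hconst : ∀ z ∈ ball c R, F z * exp (-g z) = F c := by
    intro z hz
    have hd : ∀ w ∈ ball c R, HasDerivAt (fun w ↦ F w * exp (-g w)) 0 w := by
      intro w hw
      have := (hFd w hw).mul (hg w hw).neg.cexp
      convert! this using 1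
      field_simp [h0 w hw]
      ring
    have := (convex_ball c R).is_const_of_fderivWithin_eq_zero (𝕜 := ℂ)
      (f := fun w ↦ F w * exp (-g w))
      (fun w hw ↦ (hd w hw).differentiableAt.differentiableWithinAt)
      (fun w hw ↦ by
        rw [fderivWithin_of_isOpen isOpen_ball hw]
        have := (hd w hw).hasFDerivAt.fderiv
        rw [this]; ext; simp) hz hc
    simpa [hgc] using this
  have hre : ∀ z ∈ ball c R, (g z).re ≤ A := by
    intro z hz
    have h1 := hconst z hz
    have h2 : F z = F c * exp (g z) := by
      rw [← h1, mul_assoc, ← exp_add]; simp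
    have h3 := hle z hz
    rw [h2, norm_mul, norm_exp, mul_comm] at h3
    exact Real.exp_le_exp.mp (le_of_mul_le_mul_right h3 (norm_pos_iff.mpr (h0 c hc)))
  have hbc : ∀ z ∈ sphere c r, ‖g z‖ ≤ 2 * A * r / (R - r) := by
    intro z hz
    have hz' : ‖z - c‖ = r := mem_sphere_iff_norm.mp hz
    have hmap : ∀ w ∈ ball (0 : ℂ) R, w + c ∈ ball c R := by
      intro w hw
      simpa [dist_eq_norm] using hw
    have := borelCaratheodory_zero (f := fun w ↦ g (w + c)) (M := A) (R := R) (z := z - c) hA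
      (fun w hw ↦ ((hg _ (hmap w hw)).comp_add_const w c).differentiableAt.differentiableWithinAt)
      (fun w hw ↦ hre _ (hmap w hw)) hR (by simpa [hz'] using hrR) (by simpa using hgc)
    simpa [hz'] using this
  have hsub : closure (ball c r) ⊆ ball c R :=
    closure_ball_subset_closedBall.trans (closedBall_subset_ball hrR)
  have hcont : DiffContOnCl ℂ g (ball c r) :=
    DifferentiableOn.diffContOnCl
      fun z hz ↦ (hg z (hsub hz)).differentiableAt.differentiableWithinAt
  have hcauchy := norm_iteratedDeriv_le_of_forall_mem_sphere_norm_le (m + 1) hr hcont hbc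
  rw [iteratedDeriv_succ'] at hcauchy
  have heq : deriv g =ᶠ[nhds c] fun z ↦ deriv F z / F z := by
    filter_upwards [isOpen_ball.mem_nhds hc] with z hz using (hg z hz).deriv
  rwa [heq.iteratedDeriv_eq m] at hcauchy

theorem DirichletCharacter.norm_sum_range_le {N : ℕ} [NeZero N] {χ : DirichletCharacter ℂ N}
    (hχ : χ ≠ 1) (m : ℕ) : ‖∑ j ∈ Finset.range m, χ (j : ZMod N)‖ ≤ N := by
  have hper : Function.Periodic (fun m : ℕ ↦ ∑ j ∈ Finset.range m, χ (j : ZMod N)) N := by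
    intro m
    induction m with
    | zero =>
      have h1 : ∑ j ∈ Finset.range N, χ (j : ZMod N) = ∑ a : ZMod N, χ a := by
        refine Finset.sum_bij' (fun j _ ↦ (j : ZMod N)) (fun a _ ↦ a.val) ?_ ?_ ?_ ?_ ?_
        · simp
        · intro a _; simpa using ZMod.val_lt a
        · intro j hj; exact ZMod.val_cast_of_lt (Finset.mem_range.mp hj)
        · intro a _; simp
        · simp
      simp [h1, MulChar.sum_eq_zero_of_ne_one hχ]
    | succ m ih =>
      have : m + 1 + N = (m + N) + 1 := by ring
      simp only [this, Finset.sum_range_succ] at ih ⊢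
      rw [ih]; simp
  have hlt : m % N < N := Nat.mod_lt _ (NeZero.pos N)
  have := hper.map_mod_nat m
  rw [← this]
  calc _ ≤ ∑ j ∈ Finset.range (m % N), ‖χ (j : ZMod N)‖ := norm_sum_le _ _
    _ ≤ ∑ j ∈ Finset.range (m % N), 1 := Finset.sum_le_sum fun j _ ↦ χ.norm_le_one _
    _ ≤ N := by simpa using hlt.le

theorem Complex.norm_natCast_succ_cpow_sub_le {s : ℂ} (hs : 0 < s.re) (n : ℕ) :
    ‖((n + 1 : ℕ) : ℂ) ^ (-s) - ((n + 2 : ℕ) : ℂ) ^ (-s)‖ ≤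
      ‖s‖ * ((n + 1 : ℕ) : ℝ) ^ (-s.re - 1) := by
  have hpos : (0 : ℝ) < (n + 1 : ℕ) := by positivity
  have hder : ∀ x ∈ Set.Icc ((n + 1 : ℕ) : ℝ) (n + 2 : ℕ),
      HasDerivWithinAt (fun t : ℝ ↦ (t : ℂ) ^ (-s)) (-s * (x : ℂ) ^ (-s - 1))
        (Set.Icc ((n + 1 : ℕ) : ℝ) (n + 2 : ℕ)) x := by
    intro x hx
    have hx0 : 0 < x := hpos.trans_le hx.1
    have h := (hasDerivAt_ofReal_cpow_const' (x := x) hx0.ne' (r := -s - 1)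
      (by intro h; have := congrArg Complex.re h; simp at this; linarith))
    have h2 := h.const_mul (-s)
    have hs0 : -s ≠ 0 := by intro h; have := congrArg Complex.re h; simp at this; linarith
    refine HasDerivAt.hasDerivWithinAt (h2.congr_of_eventuallyEq ?_)
    filter_upwards with t
    have hs1 : s ≠ 0 := neg_ne_zero.mp hs0
    simp only [sub_add_cancel]
    field_simp
  have hbound : ∀ x ∈ Set.Icc ((n + 1 : ℕ) : ℝ) (n + 2 : ℕ),
      ‖-s * (x : ℂ) ^ (-s - 1)‖ ≤ ‖s‖ * ((n + 1 : ℕ) : ℝ) ^ (-s.re - 1) := by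
    intro x hx
    have hx0 : 0 < x := hpos.trans_le hx.1
    rw [norm_mul, norm_neg, Complex.norm_cpow_eq_rpow_re_of_pos hx0]
    gcongr ‖s‖ * ?_
    simpa using Real.rpow_le_rpow_of_nonpos hpos hx.1 (by linarith : -s.re - 1 ≤ 0)
  have := (convex_Icc ((n + 1 : ℕ) : ℝ) (n + 2 : ℕ)).norm_image_sub_le_of_norm_hasDerivWithin_le
    hder hbound (x := ((n + 2 : ℕ) : ℝ)) (y := ((n + 1 : ℕ) : ℝ)) (by simp) (by simp)
  have h1 : ‖((n + 1 : ℕ) : ℝ) - ((n + 2 : ℕ) : ℝ)‖ = 1 := by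
    push_cast
    rw [show ((n : ℝ) + 1 - (n + 2)) = -1 by ring]; simp
  rw [h1, mul_one] at this
  simpa using this

open Complex in
/-- Polynomial growth of a nontrivial Dirichlet `L`-function to the right of `1 / 2`. -/
theorem DirichletCharacter.norm_LFunction_le {N : ℕ} [NeZero N] {χ : DirichletCharacter ℂ N}
    (hχ : χ ≠ 1) {s : ℂ} (hs : 1 / 2 < s.re) :
    ‖LFunction χ s‖ ≤ N * (‖s‖ * ∑' n : ℕ, ((n + 1 : ℕ) : ℝ) ^ (-(3 / 2) : ℝ)) := by
  set S : ℕ → ℂ := fun m ↦ ∑ j ∈ Finset.range m, χ (j : ZMod N) with hS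
  set t : ℕ → ℂ → ℂ := fun n z ↦
    S (n + 2) * (((n + 1 : ℕ) : ℂ) ^ (-z) - ((n + 2 : ℕ) : ℂ) ^ (-z)) with ht
  set U : Set ℂ := {z | 1 / 2 < z.re} with hU
  have hUo : IsOpen U := isOpen_lt continuous_const continuous_re
  have hUc : Convex ℝ U := convex_halfSpace_re_gt _
  have hsum : Summable fun n : ℕ ↦ ((n + 1 : ℕ) : ℝ) ^ (-(3 / 2) : ℝ) :=
    (summable_nat_add_iff 1).mpr (Real.summable_nat_rpow.mpr (by norm_num))
  have hbd : ∀ n, ∀ z ∈ U, ‖t n z‖ ≤ N * (‖z‖ * ((n + 1 : ℕ) : ℝ) ^ (-(3 / 2) : ℝ)) := by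
    intro n z hz
    have hz' : 1 / 2 < z.re := hz
    rw [ht, norm_mul]
    have h1 := norm_natCast_succ_cpow_sub_le (by linarith : 0 < z.re) n
    have h2 : ((n + 1 : ℕ) : ℝ) ^ (-z.re - 1) ≤ ((n + 1 : ℕ) : ℝ) ^ (-(3 / 2) : ℝ) :=
      Real.rpow_le_rpow_of_exponent_le (by simp) (by linarith)
    gcongr
    · exact norm_sum_range_le hχ _
    · exact h1.trans (by gcongr)
  have hdiffterm : ∀ n, Differentiable ℂ (t n) := by
    intro n
    have h1 : ((n + 1 : ℕ) : ℂ) ≠ 0 := by exact_mod_cast Nat.succ_ne_zero n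
    have h2 : ((n + 2 : ℕ) : ℂ) ≠ 0 := by exact_mod_cast Nat.succ_ne_zero (n + 1)
    have := NeZero.mk h1
    have := NeZero.mk h2
    simp only [ht]
    fun_prop
  have hdiff : DifferentiableOn ℂ (fun z ↦ ∑' n, t n z) U := by
    intro z hz
    set V : Set ℂ := U ∩ Metric.ball 0 (‖z‖ + 1) with hV
    have hVo : IsOpen V := hUo.inter Metric.isOpen_ball
    have hzV : z ∈ V := ⟨hz, by simp⟩
    have : DifferentiableOn ℂ (fun z ↦ ∑' n, t n z) V := by
      refine differentiableOn_tsum_of_summable_norm (u := fun n : ℕ ↦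
        N * ((‖z‖ + 1) * ((n + 1 : ℕ) : ℝ) ^ (-(3 / 2) : ℝ))) ?_ ?_ hVo ?_
      · exact (hsum.mul_left _).mul_left _
      · exact fun n ↦ (hdiffterm n).differentiableOn
      · intro n w hw
        refine (hbd n w hw.1).trans ?_
        have : ‖w‖ ≤ ‖z‖ + 1 := by simpa using (mem_ball_zero_iff.mp hw.2).le
        gcongr
    exact (this.differentiableAt (hVo.mem_nhds hzV)).differentiableWithinAt
  have hparts : ∀ (z : ℂ) (M : ℕ), ∑ n ∈ Finset.range M, t n z =
      ∑ n ∈ Finset.range M, χ ((n + 1 : ℕ) : ZMod N) * ((n + 1 : ℕ) : ℂ) ^ (-z) + χ 0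
        - S (M + 1) * ((M + 1 : ℕ) : ℂ) ^ (-z) := by
    intro z M
    induction M with
    | zero => simp [hS]
    | succ M ih =>
      rw [Finset.sum_range_succ, ih, Finset.sum_range_succ]
      have : S (M + 1 + 1) = S (M + 1) + χ ((M + 1 : ℕ) : ZMod N) := by
        simp [hS, Finset.sum_range_succ _ (M + 1)]
      simp only [ht, this]
      push_cast
      ring_nf
  have hχ0 : χ 0 = 0 := by
    have : Nontrivial (ZMod N) := by
      by_contra hn
      rw [not_nontrivial_iff_subsingleton] at hn
      exact hχ (MulChar.ext fun a ↦ by rw [Subsingleton.elim a 1]; simp)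
    exact MulChar.map_zero χ
  have hlarge : ∀ z : ℂ, 1 < z.re → ∑' n, t n z = LFunction χ z := by
    intro z hz
    have hzU : z ∈ U := by simp only [hU, Set.mem_ofPred_eq]; linarith
    have hts : Summable fun n ↦ t n z :=
      Summable.of_norm_bounded ((hsum.mul_left _).mul_left _) fun n ↦ hbd n z hzU
    have h1 := hts.hasSum.tendsto_sum_nat
    have hLs : LSeriesSummable (fun n ↦ χ (n : ZMod N)) z :=
      LSeriesSummable_of_one_lt_re χ hz
    have h2 : Filter.Tendsto (fun M ↦ ∑ n ∈ Finset.range M,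
        χ ((n + 1 : ℕ) : ZMod N) * ((n + 1 : ℕ) : ℂ) ^ (-z)) Filter.atTop
          (nhds (LFunction χ z)) := by
      rw [LFunction_eq_LSeries χ hz]
      have h3 := (hLs.hasSum.tendsto_sum_nat).comp (Filter.tendsto_add_atTop_nat 1)
      refine h3.congr fun M ↦ ?_
      simp only [Function.comp]
      rw [Finset.sum_range_succ']
      simp [LSeries.term_of_ne_zero, cpow_neg, div_eq_mul_inv]
    have h4 : Filter.Tendsto (fun M : ℕ ↦ S (M + 1) * ((M + 1 : ℕ) : ℂ) ^ (-z)) Filter.atTop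
        (nhds 0) := by
      rw [tendsto_zero_iff_norm_tendsto_zero]
      have h5 : Filter.Tendsto (fun M : ℕ ↦ (N : ℝ) * ((M + 1 : ℕ) : ℝ) ^ (-z.re)) Filter.atTop
          (nhds 0) := by
        have := (tendsto_rpow_neg_atTop (by linarith : 0 < z.re)).comp
          (tendsto_natCast_atTop_atTop.comp (Filter.tendsto_add_atTop_nat 1))
        simpa using this.const_mul (N : ℝ)
      refine squeeze_zero (fun _ ↦ norm_nonneg _) (fun M ↦ ?_) h5
      rw [norm_mul, ← ofReal_natCast, norm_cpow_eq_rpow_re_of_pos (by positivity)]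
      gcongr
      · exact norm_sum_range_le hχ _
      · simp
      · exact (neg_re z).le
    have h5 := (h2.add_const (χ 0)).sub h4
    rw [hχ0, add_zero, sub_zero] at h5
    refine tendsto_nhds_unique h1 (h5.congr fun M ↦ ?_)
    rw [hparts, hχ0]
  have heq : Set.EqOn (fun z ↦ ∑' n, t n z) (LFunction χ) U := by
    refine AnalyticOnNhd.eqOn_of_preconnected_of_eventuallyEq (z₀ := 2)
      (hdiff.analyticOnNhd hUo)
      ((differentiable_LFunction hχ).differentiableOn.analyticOnNhd hUo) hUc.isPreconnected
      (by simp [hU]; norm_num) ?_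
    filter_upwards [(isOpen_lt continuous_const continuous_re).mem_nhds
      (show (2 : ℂ) ∈ {z : ℂ | 1 < z.re} by simp)] with z hz using hlarge z hz
  rw [← heq (show s ∈ U from hs)]
  refine (tsum_of_norm_bounded ((hsum.hasSum.mul_left _).mul_left _) fun n ↦ hbd n s hs)

open ArithmeticFunction LSeries in
theorem DirichletCharacter.inv_tsum_le_norm_LFunction_two {N : ℕ} [NeZero N]
    (χ : DirichletCharacter ℂ N) :
    (∑' n : ℕ, 1 / (n : ℝ) ^ 2)⁻¹ ≤ ‖LFunction χ 2‖ := by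
  have h1 : 1 < (2 : ℂ).re := by simp
  have h := DirichletCharacter.LSeries.mul_mu_eq_one χ h1
  rw [← LFunction_eq_LSeries χ h1] at h
  have hb : ‖LSeries ((fun n : ℕ ↦ χ (n : ZMod N)) * fun n : ℕ ↦ ((moebius n : ℤ) : ℂ)) 2‖ ≤
      ∑' n : ℕ, 1 / (n : ℝ) ^ 2 := by
    refine tsum_of_norm_bounded (Real.summable_one_div_nat_pow.mpr one_lt_two).hasSum fun n ↦ ?_
    rw [norm_term_eq]
    split_ifs with hn
    · positivity
    · have h2 : ‖((fun n : ℕ ↦ χ (n : ZMod N)) * fun n : ℕ ↦ ((moebius n : ℤ) : ℂ)) n‖ ≤ 1 := by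
        rw [Pi.mul_apply, norm_mul]
        have h3 : ‖((moebius n : ℤ) : ℂ)‖ ≤ 1 := by
          rw [Complex.norm_intCast]
          exact_mod_cast abs_moebius_le_one
        exact mul_le_one₀ (χ.norm_le_one _) (norm_nonneg _) h3
      have h4 : (n : ℝ) ^ (2 : ℂ).re = (n : ℝ) ^ 2 := by
        rw [Complex.re_ofNat]; norm_cast
      rw [h4]
      gcongr
  have h5 := congrArg norm h
  rw [norm_mul, norm_one] at h5
  have hpos : 0 < ‖LFunction χ 2‖ := by
    rcases (norm_nonneg (LFunction χ 2)).eq_or_lt with h0 | h0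
    · rw [← h0] at h5; simp at h5
    · exact h0
  rw [inv_le_iff_one_le_mul₀]
  · exact h5.symm.le.trans (mul_le_mul_of_nonneg_left hb (norm_nonneg _))
  · by_contra hneg
    have := hb.trans (not_lt.mp hneg)
    rw [norm_le_zero_iff.mp this] at h5
    simp at h5

/-- Under GRH, the Taylor coefficients of the logarithmic derivative of `L` at `2` are
exponentially small, with a constant that is logarithmic in the modulus. -/
theorem GRH.exists_norm_LSeries_iterate_logMul_le (h : GRH) : ∃ K : ℝ, 2 ≤ K ∧
    ∀ (N : ℕ) [NeZero N] (χ : DirichletCharacter ℂ N), χ ≠ 1 → ∀ m : ℕ,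
      ‖LSeries (LSeries.logMul^[m] ((fun n : ℕ ↦ χ (n : ZMod N)) *
        fun n : ℕ ↦ (ArithmeticFunction.vonMangoldt n : ℂ))) 2‖ ≤
      (m + 1).factorial * (12 * Real.log (K * N)) * (5 / 6) ^ (m + 1) := by
  set K₀ : ℝ := ∑' n : ℕ, ((n + 1 : ℕ) : ℝ) ^ (-(3 / 2) : ℝ)
  set Z : ℝ := ∑' n : ℕ, 1 / (n : ℝ) ^ 2
  have hK₀ : 0 ≤ K₀ := tsum_nonneg fun n ↦ by positivity
  have hZ : 0 < Z := (Real.summable_one_div_nat_pow.mpr one_lt_two).tsum_pos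
    (fun n ↦ by positivity) 1 (by norm_num)
  refine ⟨4 * K₀ * Z + 2, le_add_of_nonneg_left (by positivity), fun N _ χ hχ m ↦ ?_⟩
  have hN : (1 : ℝ) ≤ N := by exact_mod_cast NeZero.one_le
  set K := 4 * K₀ * Z + 2
  have hK : 2 ≤ K := le_add_of_nonneg_left (by positivity)
  have hKN : 1 < K * N := by nlinarith
  have hA : 0 < Real.log (K * N) := Real.log_pos hKN
  have hball : ∀ z ∈ Metric.ball (2 : ℂ) (7 / 5), 1 / 2 < z.re ∧ ‖z‖ ≤ 4 := by
    intro z hz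
    have h1 : ‖z - 2‖ < 7 / 5 := mem_ball_iff_norm.mp hz
    have h2 := (abs_le.mp (Complex.abs_re_le_norm (z - 2))).1
    have h3 : ‖z‖ ≤ ‖z - 2‖ + ‖(2 : ℂ)‖ := by simpa using norm_add_le (z - 2) 2
    simp at h2 h3
    constructor <;> linarith
  have hlow := χ.inv_tsum_le_norm_LFunction_two
  have key := norm_iteratedDeriv_logDeriv_le (F := DirichletCharacter.LFunction χ) (c := 2)
    (r := 6 / 5) (R := 7 / 5) (by norm_num) (by norm_num) hA
    (DirichletCharacter.differentiable_LFunction hχ).differentiableOn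
    (fun z hz h0 ↦ by
      have hz' := (hball z hz).1
      rcases lt_or_ge z.re 1 with h1 | h1
      · exact hz'.ne' (h N χ z (by linarith) h1 h0)
      · exact DirichletCharacter.LFunction_ne_zero_of_one_le_re χ (Or.inl hχ) h1 h0)
    (fun z hz ↦ by
      rw [Real.exp_log (by linarith)]
      calc _ ≤ (N : ℝ) * (‖z‖ * K₀) := DirichletCharacter.norm_LFunction_le hχ (hball z hz).1
        _ ≤ N * (4 * K₀) := by gcongr; exact (hball z hz).2
        _ = (4 * K₀ * Z) * N * Z⁻¹ := by field_simp
        _ ≤ K * N * Z⁻¹ := by gcongr; exact le_add_of_nonneg_right (by norm_num)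
        _ ≤ _ := by gcongr) m
  have hab : LSeries.abscissaOfAbsConv ((fun n : ℕ ↦ χ (n : ZMod N)) *
      fun n : ℕ ↦ (ArithmeticFunction.vonMangoldt n : ℂ)) < ((2 : ℂ).re : EReal) := by
    have h1 := (DirichletCharacter.LSeriesSummable_twist_vonMangoldt χ
      (s := 3 / 2) (by norm_num)).abscissaOfAbsConv_le
    refine h1.trans_lt ?_
    norm_num
  have heq : LSeries ((fun n : ℕ ↦ χ (n : ZMod N)) *
      fun n : ℕ ↦ (ArithmeticFunction.vonMangoldt n : ℂ)) =ᶠ[nhds 2] fun z ↦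
        - (deriv (DirichletCharacter.LFunction χ) z / DirichletCharacter.LFunction χ z) := by
    filter_upwards [(isOpen_lt continuous_const Complex.continuous_re).mem_nhds
      (show (2 : ℂ) ∈ {z : ℂ | 1 < z.re} by simp)] with z hz
    rw [DirichletCharacter.LSeries_twist_vonMangoldt_eq χ hz,
      DirichletCharacter.deriv_LFunction_eq_deriv_LSeries χ hz,
      DirichletCharacter.LFunction_eq_LSeries χ hz, neg_div]
  have hid := LSeries_iteratedDeriv m hab
  rw [heq.iteratedDeriv_eq m, iteratedDeriv_fun_neg] at hid
  have hn := congrArg norm hid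
  rw [norm_neg, norm_mul, norm_pow, norm_neg, norm_one, one_pow, one_mul] at hn
  rw [← hn]
  refine key.trans (le_of_eq ?_)
  rw [show (5 / 6 : ℝ) = (6 / 5)⁻¹ by norm_num, inv_pow]
  ring

theorem Real.log_natCast_pow_div_factorial_le {a : ℝ} (ha : 0 < a) (m : ℕ) {n : ℕ} (hn : n ≠ 0) :
    Real.log n ^ m / m.factorial ≤ a⁻¹ ^ m * (n : ℝ) ^ a := by
  have hn' : (0 : ℝ) < n := by exact_mod_cast Nat.pos_of_ne_zero hn
  have h := Real.pow_div_factorial_le_exp (a * Real.log n)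
    (mul_nonneg ha.le (Real.log_natCast_nonneg n)) m
  rw [mul_comm a, ← Real.rpow_def_of_pos hn', mul_pow, mul_div_right_comm] at h
  rw [inv_pow, ← div_eq_inv_mul, le_div_iff₀ (by positivity)]
  exact h

/-- The weight `(log p) ^ (m + 1) / (m! * p ^ 2)` on odd primes `p`. -/
noncomputable def oddPrimeWeight (m n : ℕ) : ℝ :=
  if n.Prime ∧ n ≠ 2 then Real.log n * (Real.log n ^ m / m.factorial) / (n : ℝ) ^ 2 else 0

theorem oddPrimeWeight_nonneg (m n : ℕ) : 0 ≤ oddPrimeWeight m n := by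
  unfold oddPrimeWeight
  have := Real.log_natCast_nonneg n
  split_ifs <;> positivity

theorem oddPrimeWeight_le (m n : ℕ) :
    oddPrimeWeight m n ≤ 10 * (5 / 2) ^ m * (n : ℝ) ^ (-(3 / 2) : ℝ) := by
  unfold oddPrimeWeight
  split_ifs with h
  · have hn := h.1.ne_zero
    have hn' : (0 : ℝ) < n := by exact_mod_cast h.1.pos
    have h1 := Real.log_natCast_pow_div_factorial_le (a := 2 / 5) (by norm_num) m hn
    have h2 := Real.log_le_rpow_div hn'.le (by norm_num : (0 : ℝ) < 1 / 10)
    have h0 := Real.log_natCast_nonneg n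
    calc _ ≤ (n : ℝ) ^ (1 / 10 : ℝ) / (1 / 10) * ((2 / 5)⁻¹ ^ m * (n : ℝ) ^ (2 / 5 : ℝ)) /
          (n : ℝ) ^ 2 := by gcongr
      _ = 10 * (5 / 2) ^ m *
          ((n : ℝ) ^ (1 / 10 : ℝ) * (n : ℝ) ^ (2 / 5 : ℝ) / (n : ℝ) ^ (2 : ℝ)) := by
        rw [Real.rpow_two, inv_div]; ring
      _ = _ := by
        rw [← Real.rpow_add hn', ← Real.rpow_sub hn']; norm_num
  · positivity

theorem summable_oddPrimeWeight (m : ℕ) : Summable (oddPrimeWeight m) :=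
  Summable.of_nonneg_of_le (oddPrimeWeight_nonneg m) (oddPrimeWeight_le m)
    ((Real.summable_nat_rpow.mpr (by norm_num)).mul_left _)

theorem oddPrimeWeight_le_of_exp_le {m n : ℕ} (h : Real.exp (10 * m) ≤ n) :
    oddPrimeWeight m n ≤ (1 / 5) ^ m * (10 * (n : ℝ) ^ (-(6 / 5) : ℝ)) := by
  have hn' : (0 : ℝ) < n := (Real.exp_pos _).trans_le h
  have h1 : (n : ℝ) ^ (-(3 / 10) : ℝ) ≤ (2 / 25) ^ m := by
    calc (n : ℝ) ^ (-(3 / 10) : ℝ) ≤ Real.exp (10 * m) ^ (-(3 / 10) : ℝ) :=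
          Real.rpow_le_rpow_of_nonpos (Real.exp_pos _) h (by norm_num)
      _ = Real.exp (-3) ^ m := by
        rw [← Real.exp_mul, ← Real.exp_nat_mul]; ring_nf
      _ ≤ (2 / 25) ^ m := by
        gcongr
        rw [Real.exp_neg, inv_le_comm₀ (Real.exp_pos _) (by norm_num)]
        have := Real.exp_one_gt_d9
        have h3 : Real.exp 3 = Real.exp 1 ^ 3 := by rw [← Real.exp_nat_mul]; norm_num
        rw [h3]
        calc (2 / 25 : ℝ)⁻¹ ≤ 2.7 ^ 3 := by norm_num
          _ ≤ _ := by gcongr; linarith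
  calc _ ≤ 10 * (5 / 2) ^ m * (n : ℝ) ^ (-(3 / 2) : ℝ) := oddPrimeWeight_le m n
    _ = 10 * (5 / 2) ^ m * ((n : ℝ) ^ (-(3 / 10) : ℝ) * (n : ℝ) ^ (-(6 / 5) : ℝ)) := by
      rw [← Real.rpow_add hn']; norm_num
    _ ≤ 10 * (5 / 2) ^ m * ((2 / 25) ^ m * (n : ℝ) ^ (-(6 / 5) : ℝ)) := by gcongr
    _ = ((5 / 2) * (2 / 25)) ^ m * (10 * (n : ℝ) ^ (-(6 / 5) : ℝ)) := by rw [mul_pow]; ring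
    _ = _ := by norm_num

theorem oddPrimeWeight_le_of_le {m n X : ℕ} (h : n ≤ X) :
    oddPrimeWeight m n ≤ (1 / 5) ^ m * (X : ℝ) ^ 4 := by
  unfold oddPrimeWeight
  split_ifs with hp
  · have hn := hp.1.ne_zero
    have hn' : (0 : ℝ) < n := by exact_mod_cast hp.1.pos
    have h1 := Real.log_natCast_pow_div_factorial_le (a := 5) (by norm_num) m hn
    have h2 : Real.log n ≤ n := (Real.log_le_sub_one_of_pos hn').trans (by linarith)
    have h0 := Real.log_natCast_nonneg n
    calc _ ≤ (n : ℝ) * (5⁻¹ ^ m * (n : ℝ) ^ (5 : ℝ)) / (n : ℝ) ^ 2 := by gcongr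
      _ = (1 / 5) ^ m * (n : ℝ) ^ 4 := by
        rw [show (n : ℝ) ^ (5 : ℝ) = (n : ℝ) ^ 5 by norm_cast]
        field_simp
      _ ≤ _ := by gcongr
  · positivity

theorem summable_vonMangoldt_not_odd_prime :
    Summable fun n : ℕ ↦ if n.Prime ∧ n ≠ 2 then 0 else
      ArithmeticFunction.vonMangoldt n * (n : ℝ) ^ (-(3 / 4) : ℝ) := by
  set T : Set ℕ := {n | IsPrimePow n ∧ ¬ (n.Prime ∧ n ≠ 2)} with hT
  have hrep : ∀ n : T, ∃ ab : ℕ × ℕ, ab.1 ^ 2 * ab.2 ^ 3 = 8 * (n : ℕ) := by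
    rintro ⟨n, hn, hn'⟩
    obtain ⟨p, k, hp, hk, rfl⟩ := (isPrimePow_nat_iff n).mp hn
    by_cases hk1 : k = 1
    · subst hk1
      have : p = 2 := by
        by_contra h
        exact hn' (by simpa using ⟨hp, h⟩)
      exact ⟨(4, 1), by simp [this]⟩
    · rcases Nat.even_or_odd' k with ⟨j, rfl | rfl⟩
      · exact ⟨(p ^ j, 2), by simp only; ring⟩
      · obtain ⟨i, rfl⟩ : ∃ i, j = i + 1 := ⟨j - 1, by omega⟩
        exact ⟨(p ^ i, 2 * p), by simp only; ring⟩
  choose φ hφ using hrep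
  have hinj : Function.Injective φ := by
    intro a b hab
    have h1 := hφ a
    rw [hab, hφ b] at h1
    exact Subtype.ext (by omega)
  have hG : Summable fun ab : ℕ × ℕ ↦
      (ab.1 : ℝ) ^ (-(7 / 5) : ℝ) * (ab.2 : ℝ) ^ (-(21 / 10) : ℝ) :=
    Summable.mul_of_nonneg (Real.summable_nat_rpow.mpr (by norm_num))
      (Real.summable_nat_rpow.mpr (by norm_num)) (fun _ ↦ by positivity) (fun _ ↦ by positivity)
  have hTs : Summable fun n : T ↦ ((8 * (n : ℕ) : ℕ) : ℝ) ^ (-(7 / 10) : ℝ) := by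
    refine (hG.comp_injective hinj).congr fun n ↦ ?_
    rw [← hφ n]
    push_cast
    rw [Real.mul_rpow (by positivity) (by positivity), ← Real.rpow_natCast_mul (by positivity),
      ← Real.rpow_natCast_mul (by positivity)]
    norm_num
  have hind := (summable_subtype_iff_indicator (s := T)
    (f := fun n : ℕ ↦ ((8 * n : ℕ) : ℝ) ^ (-(7 / 10) : ℝ))).mp hTs
  refine Summable.of_nonneg_of_le (fun n ↦ ?_) (fun n ↦ ?_)
    (hind.mul_left (20 * 8 ^ (7 / 10 : ℝ)))
  · split_ifs
    · rfl
    · exact mul_nonneg ArithmeticFunction.vonMangoldt_nonneg (by positivity)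
  · by_cases hn : n ∈ T
    · have hpp : IsPrimePow n := hn.1
      have hn' : (0 : ℝ) < n := by exact_mod_cast hpp.pos
      rw [Set.indicator_of_mem hn, if_neg hn.2]
      have h2 := Real.log_le_rpow_div hn'.le (by norm_num : (0 : ℝ) < 1 / 20)
      calc _ ≤ (n : ℝ) ^ (1 / 20 : ℝ) / (1 / 20) * (n : ℝ) ^ (-(3 / 4) : ℝ) := by
            gcongr; exact ArithmeticFunction.vonMangoldt_le_log.trans h2
        _ = 20 * (n : ℝ) ^ (-(7 / 10) : ℝ) := by
          rw [div_mul_eq_mul_div, ← Real.rpow_add hn']; norm_num; ring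
        _ = _ := by
          push_cast
          rw [Real.mul_rpow (by norm_num) hn'.le, Real.rpow_neg (by norm_num : (0 : ℝ) ≤ 8)]
          field_simp
    · rw [Set.indicator_of_notMem hn, mul_zero]
      split_ifs with hp
      · rfl
      · have : ¬ IsPrimePow n := fun h ↦ hn ⟨h, hp⟩
        rw [ArithmeticFunction.vonMangoldt_eq_zero_iff.mpr this, zero_mul]

theorem LSeries.iterate_logMul_apply (f : ℕ → ℂ) (m n : ℕ) :
    logMul^[m] f n = (Real.log n : ℂ) ^ m * f n := by
  induction m with
  | zero => simp
  | succ m ih =>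
    rw [Function.iterate_succ_apply', logMul, ih, Complex.natCast_log, pow_succ']
    ring

/-- Under GRH, nontrivial characters have exponentially small weighted sums over odd primes. -/
theorem GRH.exists_norm_tsum_oddPrimeWeight_le (h : GRH) : ∃ C K : ℝ, 0 < C ∧ 2 ≤ K ∧
    ∀ (N : ℕ) [NeZero N] (χ : DirichletCharacter ℂ N), χ ≠ 1 → ∀ m : ℕ,
      ‖∑' n : ℕ, χ (n : ZMod N) * (oddPrimeWeight m n : ℂ)‖ ≤
        C * (m + 1) * Real.log (K * N) * (5 / 6) ^ m := by
  obtain ⟨K, hK, hbound⟩ := h.exists_norm_LSeries_iterate_logMul_le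
  set V : ℕ → ℝ := fun n ↦ if n.Prime ∧ n ≠ 2 then 0 else
      ArithmeticFunction.vonMangoldt n * (n : ℝ) ^ (-(3 / 4) : ℝ) with hV
  have hVs : Summable V := summable_vonMangoldt_not_odd_prime
  have hV0 : ∀ n, 0 ≤ V n := fun n ↦ by
    simp only [hV]
    split_ifs
    · rfl
    · exact mul_nonneg ArithmeticFunction.vonMangoldt_nonneg (by positivity)
  have hlog2 : 0 < Real.log 2 := Real.log_pos one_lt_two
  have hV1 : 0 ≤ ∑' n, V n := tsum_nonneg hV0
  refine ⟨10 + (∑' n, V n) / Real.log 2, K, by positivity, hK, fun N _ χ hχ m ↦ ?_⟩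
  have hN : (1 : ℝ) ≤ N := by exact_mod_cast NeZero.one_le
  have hlog : Real.log 2 ≤ Real.log (K * N) := Real.log_le_log two_pos (by nlinarith)
  set f : ℕ → ℂ := (fun n : ℕ ↦ χ (n : ZMod N)) *
        fun n : ℕ ↦ (ArithmeticFunction.vonMangoldt n : ℂ) with hf
  set v : ℕ → ℂ := fun n ↦ LSeries.term (LSeries.logMul^[m] f) 2 n / m.factorial -
    χ (n : ZMod N) * (oddPrimeWeight m n : ℂ) with hv
  have hterm : ∀ n : ℕ, n ≠ 0 → LSeries.term (LSeries.logMul^[m] f) 2 n / m.factorial =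
      χ (n : ZMod N) * ((ArithmeticFunction.vonMangoldt n *
        (Real.log n ^ m / m.factorial) / (n : ℝ) ^ 2 : ℝ) : ℂ) := by
    intro n hn
    rw [LSeries.term_of_ne_zero hn, LSeries.iterate_logMul_apply, hf, Pi.mul_apply,
      Complex.cpow_ofNat]
    push_cast
    ring
  have hvle : ∀ n, ‖v n‖ ≤ (4 / 5) ^ m * V n := by
    intro n
    rcases eq_or_ne n 0 with rfl | hn
    · simp [hv, oddPrimeWeight]
      exact mul_nonneg (by positivity) (hV0 0)
    have hn' : (0 : ℝ) < n := by exact_mod_cast Nat.pos_of_ne_zero hn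
    simp only [hv, hterm n hn, hV, oddPrimeWeight]
    split_ifs with hp
    · rw [ArithmeticFunction.vonMangoldt_apply_prime hp.1]; simp
    · have h1 := Real.log_natCast_pow_div_factorial_le (a := 5 / 4) (by norm_num) m hn
      have h0 := Real.log_natCast_nonneg n
      have hΛ : 0 ≤ ArithmeticFunction.vonMangoldt n := ArithmeticFunction.vonMangoldt_nonneg
      rw [Complex.ofReal_zero, mul_zero, sub_zero, norm_mul, Complex.norm_real,
        Real.norm_of_nonneg (by positivity)]
      calc _ ≤ 1 * (ArithmeticFunction.vonMangoldt n *
            ((5 / 4)⁻¹ ^ m * (n : ℝ) ^ (5 / 4 : ℝ)) / (n : ℝ) ^ 2) := by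
            gcongr; exact χ.norm_le_one _
        _ = (4 / 5) ^ m * (ArithmeticFunction.vonMangoldt n *
            ((n : ℝ) ^ (5 / 4 : ℝ) / (n : ℝ) ^ (2 : ℝ))) := by
          rw [Real.rpow_two, inv_div]; ring
        _ = _ := by rw [← Real.rpow_sub hn']; norm_num
  have hvs : Summable v := Summable.of_norm_bounded (hVs.mul_left _) hvle
  have hws : Summable fun n : ℕ ↦ χ (n : ZMod N) * (oddPrimeWeight m n : ℂ) := by
    refine Summable.of_norm_bounded (summable_oddPrimeWeight m) fun n ↦ ?_
    rw [norm_mul, Complex.norm_real, Real.norm_of_nonneg (oddPrimeWeight_nonneg m n)]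
    exact mul_le_of_le_one_left (oddPrimeWeight_nonneg m n) (χ.norm_le_one _)
  have hsum : LSeries (LSeries.logMul^[m] f) 2 / m.factorial =
      ∑' n, v n + ∑' n : ℕ, χ (n : ZMod N) * (oddPrimeWeight m n : ℂ) := by
    rw [← hvs.tsum_add hws, LSeries, ← tsum_div_const]
    exact tsum_congr fun n ↦ by simp [hv]
  have hfac' : (0 : ℝ) < m.factorial := by exact_mod_cast m.factorial_pos
  have hL := hbound N χ hχ m
  have h1 : ‖∑' n : ℕ, χ (n : ZMod N) * (oddPrimeWeight m n : ℂ)‖ ≤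
      (m + 1) * (12 * Real.log (K * N)) * (5 / 6) ^ (m + 1) + (4 / 5) ^ m * ∑' n, V n := by
    rw [← sub_eq_iff_eq_add'.mpr hsum]
    refine (norm_sub_le _ _).trans (add_le_add ?_ ?_)
    · rw [norm_div, Complex.norm_natCast, div_le_iff₀ hfac']
      refine hL.trans (le_of_eq ?_)
      rw [Nat.factorial_succ]; push_cast; ring
    · exact tsum_of_norm_bounded (hVs.hasSum.mul_left _) hvle
  refine h1.trans ?_
  have h2 : (4 / 5 : ℝ) ^ m ≤ (5 / 6) ^ m := pow_le_pow_left₀ (by norm_num) (by norm_num) m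
  have h3 : ∑' n, V n ≤ (∑' n, V n) / Real.log 2 * (m + 1) * Real.log (K * N) := by
    calc ∑' n, V n = (∑' n, V n) / Real.log 2 * 1 * Real.log 2 := by field_simp
      _ ≤ _ := by gcongr; linarith [(Nat.cast_nonneg m : (0 : ℝ) ≤ m)]
  calc _ ≤ (m + 1) * (12 * Real.log (K * N)) * (5 / 6) ^ (m + 1) + (5 / 6) ^ m *
      ((∑' n, V n) / Real.log 2 * (m + 1) * Real.log (K * N)) := by gcongr
    _ = _ := by rw [pow_succ]; ring

/-- The Dirichlet character modulo `4 * d` given on units by the Jacobi symbol `(d / ·)`. -/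
noncomputable def jacobiCharacter (d : ℕ) [NeZero d] : DirichletCharacter ℂ (4 * d) where
  toFun a := open Classical in if IsUnit a then (jacobiSym d a.val : ℂ) else 0
  map_one' := by
    have : Fact (1 < 4 * d) := ⟨by have := NeZero.pos d; omega⟩
    rw [if_pos isUnit_one, ZMod.val_one, jacobiSym.one_right, Int.cast_one]
  map_mul' a b := by
    classical
    by_cases ha : IsUnit a
    · by_cases hb : IsUnit b
      · have hodd : ∀ c : ZMod (4 * d), IsUnit c → Odd c.val := fun c hc ↦ by
          have h1 : c.val.Coprime (4 * d) := ZMod.isUnit_iff_coprime _ _ |>.mp (by simpa using hc)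
          exact Nat.coprime_two_right.mp (h1.coprime_mul_right_right.coprime_dvd_right ⟨2, rfl⟩)
        have hab := (hodd a ha).mul (hodd b hb)
        have hz : ∀ c : ZMod (4 * d), IsUnit c → c.val ≠ 0 := fun c hc h ↦ by
          have := hodd c hc
          simp [h] at this
        rw [if_pos (ha.mul hb), if_pos ha, if_pos hb, ZMod.val_mul, ← jacobiSym.mod_right' d hab,
          jacobiSym.mul_right' _ (hz a ha) (hz b hb), Int.cast_mul]
      · simp [hb]
    · simp [ha]
  map_nonunit' a ha := if_neg ha

theorem jacobiCharacter_natCast {d n : ℕ} [NeZero d] (hn : n.Coprime 2) :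
    jacobiCharacter d (n : ZMod (4 * d)) = (jacobiSym d n : ℂ) := by
  classical
  have h4 : n.Coprime 4 := Nat.Coprime.pow_right 2 hn
  change (if IsUnit (n : ZMod (4 * d)) then _ else _) = _
  split_ifs with h
  · rw [ZMod.val_natCast, ← jacobiSym.mod_right' d (Nat.coprime_two_right.mp hn)]
  · have : NeZero n := ⟨by rintro rfl; simp at hn⟩
    rw [ZMod.isUnit_iff_coprime] at h
    rw [jacobiSym.eq_zero_iff_not_coprime.mpr, Int.cast_zero]
    rw [Int.gcd_natCast_natCast, Nat.gcd_comm]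
    exact fun h' ↦ h (h4.mul_right h')

theorem jacobiCharacter_mul_oddPrimeWeight (d m n : ℕ) [NeZero d] :
    jacobiCharacter d (n : ZMod (4 * d)) * (oddPrimeWeight m n : ℂ) =
      ((jacobiSym d n * oddPrimeWeight m n : ℝ) : ℂ) := by
  by_cases h : n.Prime ∧ n ≠ 2
  · rw [jacobiCharacter_natCast ((Nat.coprime_primes h.1 Nat.prime_two).mpr h.2)]
    push_cast
    rfl
  · simp [oddPrimeWeight, h]

/-- Under GRH, weighted sums of Jacobi symbols over odd primes are not very negative. -/
theorem GRH.exists_neg_le_tsum_jacobiSym (h : GRH) : ∃ C K : ℝ, 0 < C ∧ 2 ≤ K ∧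
    ∀ d m : ℕ, d ≠ 0 → -(C * (m + 1) * Real.log (K * (4 * d : ℕ)) * (5 / 6) ^ m) ≤
      ∑' n : ℕ, (jacobiSym d n : ℝ) * oddPrimeWeight m n := by
  obtain ⟨C, K, hC, hK, hb⟩ := h.exists_norm_tsum_oddPrimeWeight_le
  refine ⟨C, K, hC, hK, fun d m hd ↦ ?_⟩
  have : NeZero d := ⟨hd⟩
  have hd1 : (1 : ℝ) ≤ (4 * d : ℕ) := by exact_mod_cast (NeZero.one_le : 1 ≤ 4 * d)
  by_cases hχ : jacobiCharacter d = 1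
  · have hlog : 0 ≤ Real.log (K * (4 * d : ℕ)) := Real.log_nonneg (by nlinarith)
    refine (neg_nonpos.mpr (by positivity)).trans (tsum_nonneg fun n ↦ ?_)
    have h1 := jacobiCharacter_mul_oddPrimeWeight d m n
    have h0 := oddPrimeWeight_nonneg m n
    rw [hχ] at h1
    by_cases hu : IsUnit (n : ZMod (4 * d))
    · rw [MulChar.one_apply hu, one_mul] at h1
      exact (Complex.ofReal_injective h1) ▸ h0
    · rw [MulChar.map_nonunit _ hu, zero_mul, eq_comm, Complex.ofReal_eq_zero] at h1
      exact h1.ge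
  · have h1 := hb (4 * d) (jacobiCharacter d) hχ m
    simp_rw [jacobiCharacter_mul_oddPrimeWeight] at h1
    rw [← Complex.ofReal_tsum, Complex.norm_real] at h1
    exact (abs_le.mp h1).1

theorem abs_jacobiSym_le_one (a : ℤ) (b : ℕ) : |(jacobiSym a b : ℝ)| ≤ 1 := by
  rcases jacobiSym.trichotomy a b with h | h | h <;> simp [h]

theorem jacobiSym_prod_left (D : Finset ℕ) (n : ℕ) :
    ∏ q ∈ D, (jacobiSym (q : ℤ) n : ℝ) = (jacobiSym ((∏ q ∈ D, q : ℕ) : ℤ) n : ℝ) := by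
  classical
  induction D using Finset.induction_on with
  | empty => simp [jacobiSym.one_left]
  | insert a s ha ih =>
    rw [Finset.prod_insert ha, Finset.prod_insert ha, ih, Nat.cast_mul, jacobiSym.mul_left,
      Int.cast_mul]

/-- Expansion of the product `∏ (1 + (q / n))` in the weighted sum over odd primes. -/
theorem GRH.exists_tsum_oddPrimeWeight_le (h : GRH) : ∃ C K : ℝ, 0 < C ∧ 2 ≤ K ∧
    ∀ (P : Finset ℕ) (m B : ℕ), (∀ q ∈ P, q ≠ 0) → ∏ q ∈ P, q ≤ B →
      ∑' n, oddPrimeWeight m n ≤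
        ∑' n : ℕ, (∏ q ∈ P, (1 + (jacobiSym (q : ℤ) n : ℝ))) * oddPrimeWeight m n +
          2 ^ P.card * (C * (m + 1) * Real.log (K * (4 * B : ℕ)) * (5 / 6) ^ m) := by
  classical
  obtain ⟨C, K, hC, hK, hb⟩ := h.exists_neg_le_tsum_jacobiSym
  refine ⟨C, K, hC, hK, fun P m B hP hB ↦ ?_⟩
  set E : ℝ := C * (m + 1) * Real.log (K * (4 * B : ℕ)) * (5 / 6) ^ m with hE
  have hP1 : 1 ≤ ∏ q ∈ P, q := Nat.one_le_iff_ne_zero.mpr (Finset.prod_ne_zero_iff.mpr hP)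
  have hB1 : (1 : ℝ) ≤ B := by exact_mod_cast hP1.trans hB
  have hE0 : 0 ≤ E := by
    have : 0 ≤ Real.log (K * (4 * B : ℕ)) := Real.log_nonneg (by push_cast; nlinarith)
    positivity
  have hs : ∀ D : Finset ℕ,
      Summable fun n : ℕ ↦ (∏ q ∈ D, (jacobiSym (q : ℤ) n : ℝ)) * oddPrimeWeight m n := by
    intro D
    refine Summable.of_norm_bounded (summable_oddPrimeWeight m) fun n ↦ ?_
    rw [jacobiSym_prod_left, norm_mul, Real.norm_of_nonneg (oddPrimeWeight_nonneg m n)]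
    exact mul_le_of_le_one_left (oddPrimeWeight_nonneg m n) (abs_jacobiSym_le_one _ _)
  have hexp : ∑' n : ℕ, (∏ q ∈ P, (1 + (jacobiSym (q : ℤ) n : ℝ))) * oddPrimeWeight m n =
      ∑ D ∈ P.powerset, ∑' n : ℕ, (∏ q ∈ D, (jacobiSym (q : ℤ) n : ℝ)) * oddPrimeWeight m n := by
    rw [← Summable.tsum_finsetSum fun D _ ↦ hs D]
    exact tsum_congr fun n ↦ by rw [Finset.prod_one_add, Finset.sum_mul]
  rw [hexp, ← Finset.add_sum_erase _ _ (Finset.empty_mem_powerset P)]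
  have hle : -(2 ^ P.card * E) ≤ ∑ D ∈ P.powerset.erase ∅,
      ∑' n : ℕ, (∏ q ∈ D, (jacobiSym (q : ℤ) n : ℝ)) * oddPrimeWeight m n := by
    calc -(2 ^ P.card * E) = -∑ D ∈ P.powerset, E := by simp
      _ ≤ -∑ D ∈ P.powerset.erase ∅, E := by
        gcongr
        exact Finset.erase_subset _ _
      _ = ∑ D ∈ P.powerset.erase ∅, -E := by rw [Finset.sum_neg_distrib]
      _ ≤ _ := Finset.sum_le_sum fun D hD ↦ ?_
    have hDP := Finset.mem_powerset.mp (Finset.mem_of_mem_erase hD)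
    have hD0 : ∏ q ∈ D, q ≠ 0 := Finset.prod_ne_zero_iff.mpr fun q hq ↦ hP q (hDP hq)
    have hDB : ∏ q ∈ D, q ≤ B :=
      (Nat.le_of_dvd hP1 (Finset.prod_dvd_prod_of_subset D P (fun q ↦ q) hDP)).trans hB
    simp_rw [jacobiSym_prod_left]
    refine le_trans (neg_le_neg ?_) (hb (∏ q ∈ D, q) m hD0)
    have : (0 : ℝ) < (4 * (∏ q ∈ D, q) : ℕ) := by exact_mod_cast Nat.pos_of_ne_zero (by positivity)
    rw [hE]
    gcongr
  simp only [Finset.prod_empty, one_mul]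
  linarith

theorem hasSum_oddPrimeWeight (n : ℕ) :
    HasSum (fun m ↦ oddPrimeWeight m n) (if n.Prime ∧ n ≠ 2 then Real.log n / n else 0) := by
  unfold oddPrimeWeight
  split_ifs with h
  · have hn : (0 : ℝ) < n := by exact_mod_cast h.1.pos
    have h1 : HasSum (fun m : ℕ ↦ Real.log n ^ m / m.factorial) (n : ℝ) := by
      have := NormedSpace.expSeries_div_hasSum_exp (Real.log n)
      rwa [← Real.exp_eq_exp_ℝ, Real.exp_log hn] at this
    have h2 : Real.log n / n = Real.log n * n / (n : ℝ) ^ 2 := by field_simp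
    rw [h2]
    exact (h1.mul_left (Real.log n)).div_const _
  · exact hasSum_zero

theorem not_summable_tsum_oddPrimeWeight : ¬ Summable fun m ↦ ∑' n, oddPrimeWeight m n := by
  intro h
  have h1 : Summable fun x : ℕ × ℕ ↦ oddPrimeWeight x.1 x.2 :=
    (summable_prod_of_nonneg fun x ↦ oddPrimeWeight_nonneg x.1 x.2).mpr
      ⟨summable_oddPrimeWeight, h⟩
  have h2 := h1.prod_symm.prod
  simp only [Prod.fst_swap, Prod.snd_swap, (hasSum_oddPrimeWeight _).tsum_eq] at h2
  apply not_summable_one_div_on_primes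
  refine Summable.of_nonneg_of_le (fun n ↦ Set.indicator_nonneg (fun _ _ ↦ by positivity) n)
    (fun n ↦ ?_) (h2.add (summable_of_ne_finset_zero (s := {2})
      (f := fun n : ℕ ↦ if n = 2 then (1 : ℝ) else 0) fun n hn ↦ if_neg (by simpa using hn)))
  by_cases hp : n.Prime
  · rw [Set.indicator_of_mem (by exact hp)]
    by_cases h2 : n = 2
    · subst h2; norm_num
    · have h3 : 3 ≤ n := by have := hp.two_le; omega
      have h3' : (3 : ℝ) ≤ n := by exact_mod_cast h3
      rw [if_pos ⟨hp, h2⟩, if_neg h2, add_zero]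
      gcongr
      rw [Real.le_log_iff_exp_le (by linarith)]
      linarith [Real.exp_one_lt_d9]
  · rw [Set.indicator_of_notMem (by exact hp)]
    simp only [hp, false_and, if_false]
    split_ifs <;> norm_num

theorem frequently_pow_le_tsum_oddPrimeWeight :
    ∃ᶠ m : ℕ in Filter.atTop, (19 / 20 : ℝ) ^ m ≤ ∑' n, oddPrimeWeight m n := by
  intro h
  refine not_summable_tsum_oddPrimeWeight (Summable.of_norm_bounded_eventually_nat
    (summable_geometric_of_lt_one (by norm_num) (by norm_num : (19 / 20 : ℝ) < 1)) ?_)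
  filter_upwards [h] with m hm
  rw [Real.norm_of_nonneg (tsum_nonneg (oddPrimeWeight_nonneg m))]
  exact (not_le.mp hm).le

/-- If no prime in `(X, exp (10 m))` makes the product nonzero, the weighted sum is tiny. -/
theorem tsum_prod_mul_oddPrimeWeight_le {P : Finset ℕ} {m X : ℕ}
    (h : ∀ n : ℕ, n.Prime → n ≠ 2 → X < n → (n : ℝ) < Real.exp (10 * m) →
      ∏ q ∈ P, (1 + (jacobiSym (q : ℤ) n : ℝ)) = 0) :
    ∑' n : ℕ, (∏ q ∈ P, (1 + (jacobiSym (q : ℤ) n : ℝ))) * oddPrimeWeight m n ≤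
      2 ^ P.card * ((1 / 5) ^ m *
        ((X + 1) * (X : ℝ) ^ 4 + 10 * ∑' n : ℕ, (n : ℝ) ^ (-(6 / 5) : ℝ))) := by
  have hprod : ∀ n : ℕ, 0 ≤ ∏ q ∈ P, (1 + (jacobiSym (q : ℤ) n : ℝ)) ∧
      ∏ q ∈ P, (1 + (jacobiSym (q : ℤ) n : ℝ)) ≤ 2 ^ P.card := by
    intro n
    have h1 : ∀ q ∈ P, 0 ≤ 1 + (jacobiSym (q : ℤ) n : ℝ) := fun q _ ↦ by
      linarith [(abs_le.mp (abs_jacobiSym_le_one q n)).1]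
    exact ⟨Finset.prod_nonneg h1, (Finset.prod_le_prod h1 fun q _ ↦ by
      linarith [(abs_le.mp (abs_jacobiSym_le_one q n)).2]).trans_eq (Finset.prod_const 2)⟩
  have hs : HasSum (fun n : ℕ ↦ if n ∈ Finset.range (X + 1) then (X : ℝ) ^ 4 else 0)
      ((X + 1) * (X : ℝ) ^ 4) := by
    have := hasSum_sum_of_ne_finset_zero (s := Finset.range (X + 1))
      (f := fun n : ℕ ↦ if n ∈ Finset.range (X + 1) then (X : ℝ) ^ 4 else 0)
      (L := SummationFilter.unconditional ℕ) fun n hn ↦ if_neg hn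
    rwa [Finset.sum_ite_mem, Finset.inter_self, Finset.sum_const, Finset.card_range,
      nsmul_eq_mul, Nat.cast_add_one] at this
  have hz : Summable fun n : ℕ ↦ (n : ℝ) ^ (-(6 / 5) : ℝ) :=
    Real.summable_nat_rpow.mpr (by norm_num)
  have hmaj := ((hs.add (hz.hasSum.mul_left 10)).mul_left ((1 / 5 : ℝ) ^ m)).mul_left
    (2 ^ P.card : ℝ)
  refine (Real.le_norm_self _).trans (tsum_of_norm_bounded hmaj fun n ↦ ?_)
  have h0 := oddPrimeWeight_nonneg m n
  rw [Real.norm_of_nonneg (mul_nonneg (hprod n).1 h0)]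
  by_cases hX : n ≤ X
  · rw [if_pos (by simpa [Nat.lt_succ_iff] using hX)]
    calc _ ≤ 2 ^ P.card * ((1 / 5) ^ m * (X : ℝ) ^ 4) :=
          mul_le_mul (hprod n).2 (oddPrimeWeight_le_of_le hX) h0 (by positivity)
      _ ≤ _ := by
        gcongr
        exact le_add_of_nonneg_right (by positivity)
  · rw [if_neg (by simpa [Nat.lt_succ_iff] using hX), zero_add]
    rcases le_or_gt (Real.exp (10 * m)) n with he | he
    · exact mul_le_mul (hprod n).2 (oddPrimeWeight_le_of_exp_le he) h0 (by positivity)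
    · by_cases hp : n.Prime ∧ n ≠ 2
      · rw [h n hp.1 hp.2 (not_le.mp hX) he, zero_mul]
        positivity
      · rw [oddPrimeWeight, if_neg hp, mul_zero]
        positivity

theorem eventually_primeCounting_mul_log_le :
    ∀ᶠ m : ℕ in Filter.atTop, 8 * Nat.primeCounting ⌊m * Real.log m / 32⌋₊ ≤ m := by
  have hlog : Filter.Tendsto (fun m : ℕ ↦ Real.log m) Filter.atTop Filter.atTop :=
    Real.tendsto_log_atTop.comp tendsto_natCast_atTop_atTop
  have hx : Filter.Tendsto (fun m : ℕ ↦ (m : ℝ) * Real.log m / 32) Filter.atTop Filter.atTop :=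
    (tendsto_natCast_atTop_atTop.atTop_mul_atTop₀ hlog).atTop_div_const (by norm_num)
  filter_upwards [hx.eventually (Chebyshev.eventually_primeCounting_le
    (by norm_num : (0 : ℝ) < 1 / 10)), hlog.eventually_ge_atTop 32,
    Filter.eventually_ge_atTop 2] with m hm hl hm2
  have hm0 : (2 : ℝ) ≤ m := by exact_mod_cast hm2
  have hl0 : Real.log m ≤ Real.log (m * Real.log m / 32) :=
    Real.log_le_log (by linarith) (by nlinarith)
  have h4 : Real.log 4 ≤ 1.4 := by
    rw [show (4 : ℝ) = 2 ^ 2 by norm_num, Real.log_pow]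
    have := Real.log_two_lt_d9
    push_cast
    linarith
  have h1 : (Nat.primeCounting ⌊m * Real.log m / 32⌋₊ : ℝ) ≤ m / 8 := by
    refine hm.trans ?_
    rw [div_le_iff₀ (by linarith)]
    calc (Real.log 4 + 1 / 10) * (m * Real.log m / 32) ≤ 4 * (m * Real.log m / 32) := by
          gcongr; linarith
      _ = m / 8 * Real.log m := by ring
      _ ≤ _ := by gcongr
  have h2 : (8 * Nat.primeCounting ⌊m * Real.log m / 32⌋₊ : ℝ) ≤ m := by linarith
  exact_mod_cast h2

theorem eventually_pow_primeCounting_mul_lt (C K Z : ℝ) (hC : 0 < C) (hK : 2 ≤ K) (hZ : 0 ≤ Z) :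
    ∀ᶠ m : ℕ in Filter.atTop, ∀ X : ℕ, X = ⌊m * Real.log m / 32⌋₊ →
      2 ^ Nat.primeCounting X * ((1 / 5) ^ m * ((X + 1) * (X : ℝ) ^ 4 + 10 * Z)) +
        2 ^ Nat.primeCounting X *
          (C * (m + 1) * Real.log (K * (4 * 4 ^ X : ℕ)) * (5 / 6) ^ m) < (19 / 20) ^ m := by
  have hr (k : ℕ) : Filter.Tendsto (fun m : ℕ ↦ (m : ℝ) ^ k * (22 / 95) ^ m) Filter.atTop
      (nhds 0) := tendsto_pow_const_mul_const_pow_of_abs_lt_one k (by rw [abs_of_pos] <;> norm_num)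
  have hs (k : ℕ) : Filter.Tendsto (fun m : ℕ ↦ (m : ℝ) ^ k * (55 / 57) ^ m) Filter.atTop
      (nhds 0) := tendsto_pow_const_mul_const_pow_of_abs_lt_one k (by rw [abs_of_pos] <;> norm_num)
  have hlim := ((((hr 10).add (hr 8)).add ((hr 0).const_mul (10 * Z))).add
    ((((hs 1).add (hs 0)).const_mul (C * Real.log (4 * K))).add
      (((hs 3).add (hs 2)).const_mul (C * 2))))
  simp only [add_zero, mul_zero] at hlim
  filter_upwards [hlim.eventually_lt_const one_pos, eventually_primeCounting_mul_log_le] with m hm hπ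
  rintro X hX
  rw [← hX] at hπ
  have hXm : (X : ℝ) ≤ (m : ℝ) ^ 2 := by
    rcases Nat.eq_zero_or_pos m with rfl | hm0
    · simp [hX]
    have hm0' : (0 : ℝ) < m := by exact_mod_cast hm0
    have hl := Real.log_le_sub_one_of_pos hm0'
    have hl0 := Real.log_natCast_nonneg m
    rw [hX]
    refine (Nat.floor_le (by positivity)).trans ?_
    nlinarith
  have h2 : (2 : ℝ) ^ Nat.primeCounting X ≤ (11 / 10) ^ m := by
    calc (2 : ℝ) ^ Nat.primeCounting X ≤ ((11 / 10) ^ 8) ^ Nat.primeCounting X := by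
          gcongr; norm_num
      _ = (11 / 10) ^ (8 * Nat.primeCounting X) := by rw [pow_mul]
      _ ≤ _ := pow_le_pow_right₀ (by norm_num) hπ
  have hlog : 0 ≤ Real.log (K * (4 * 4 ^ X : ℕ)) := by
    have : (1 : ℝ) ≤ (4 * 4 ^ X : ℕ) := by exact_mod_cast Nat.one_le_iff_ne_zero.mpr (by positivity)
    exact Real.log_nonneg (by nlinarith)
  have h4 : Real.log 4 ≤ 2 := by
    rw [show (4 : ℝ) = 2 ^ 2 by norm_num, Real.log_pow]
    have := Real.log_two_lt_d9
    push_cast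
    linarith
  have hL0 : 0 ≤ Real.log (4 * K) := Real.log_nonneg (by linarith)
  have hL : Real.log (K * (4 * 4 ^ X : ℕ)) ≤ Real.log (4 * K) + 2 * (m : ℝ) ^ 2 := by
    push_cast
    rw [← mul_assoc, mul_comm K, Real.log_mul (by positivity) (by positivity), Real.log_pow]
    nlinarith [Real.log_nonneg (by norm_num : (1 : ℝ) ≤ 4)]
  calc _ ≤ (11 / 10) ^ m * ((1 / 5) ^ m * (((m : ℝ) ^ 2 + 1) * ((m : ℝ) ^ 2) ^ 4 + 10 * Z)) +
        (11 / 10) ^ m * (C * (m + 1) * (Real.log (4 * K) + 2 * (m : ℝ) ^ 2) * (5 / 6) ^ m) := by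
        gcongr
    _ = (11 / 10 * (1 / 5)) ^ m * (((m : ℝ) ^ 2 + 1) * ((m : ℝ) ^ 2) ^ 4 + 10 * Z) +
        (11 / 10 * (5 / 6)) ^ m * (C * (m + 1) * (Real.log (4 * K) + 2 * (m : ℝ) ^ 2)) := by
        rw [mul_pow, mul_pow]; ring
    _ = (19 / 20 * (22 / 95)) ^ m * (((m : ℝ) ^ 2 + 1) * ((m : ℝ) ^ 2) ^ 4 + 10 * Z) +
        (19 / 20 * (55 / 57)) ^ m * (C * (m + 1) * (Real.log (4 * K) + 2 * (m : ℝ) ^ 2)) := by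
        norm_num
    _ = (19 / 20) ^ m * ((m : ℝ) ^ 10 * (22 / 95) ^ m + (m : ℝ) ^ 8 * (22 / 95) ^ m +
        10 * Z * ((m : ℝ) ^ 0 * (22 / 95) ^ m) +
        (C * Real.log (4 * K) * ((m : ℝ) ^ 1 * (55 / 57) ^ m + (m : ℝ) ^ 0 * (55 / 57) ^ m) +
          C * 2 * ((m : ℝ) ^ 3 * (55 / 57) ^ m + (m : ℝ) ^ 2 * (55 / 57) ^ m))) := by
        rw [mul_pow, mul_pow]; ring
    _ < (19 / 20) ^ m * 1 := by gcongr
    _ = _ := mul_one _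

/-- Under GRH, there are infinitely many `m` admitting a prime below `exp (10 m)` modulo which
all primes up to `m log m / 32` are quadratic residues. -/
theorem GRH.frequently_exists_prime (h : GRH) : ∃ᶠ m : ℕ in Filter.atTop,
    ∃ p : ℕ, p.Prime ∧ ⌊m * Real.log m / 32⌋₊ < p ∧ (p : ℝ) < Real.exp (10 * m) ∧
      ∀ q : ℕ, q.Prime → q ≤ ⌊m * Real.log m / 32⌋₊ → jacobiSym (q : ℤ) p = 1 := by
  obtain ⟨C, K, hC, hK, hb⟩ := h.exists_tsum_oddPrimeWeight_le
  have hZ : 0 ≤ ∑' n : ℕ, (n : ℝ) ^ (-(6 / 5) : ℝ) := tsum_nonneg fun _ ↦ by positivity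
  refine (frequently_pow_le_tsum_oddPrimeWeight.and_eventually
    (eventually_pow_primeCounting_mul_lt C K _ hC hK hZ)).mono ?_
  rintro m ⟨hF, hlt⟩
  specialize hlt _ rfl
  set X : ℕ := ⌊m * Real.log m / 32⌋₊
  by_contra! hno
  have h1 := hb (Nat.primesLE X) m (4 ^ X) (fun q hq ↦ (Nat.prime_of_mem_primesLE hq).ne_zero)
    (primorial_le_four_pow X)
  have h2 := tsum_prod_mul_oddPrimeWeight_le (P := Nat.primesLE X) (m := m) (X := X) ?_
  · rw [Nat.primesLE_card_eq_primeCounting] at h1 h2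
    linarith
  · intro p hp _ hXp hpe
    obtain ⟨q, hq, hqX, hq1⟩ := hno p hp hXp hpe
    refine Finset.prod_eq_zero (Nat.mem_primesLE.mpr ⟨hqX, hq⟩) ?_
    have hcop : Int.gcd (q : ℤ) p = 1 := by
      rw [Int.gcd_natCast_natCast]
      exact (Nat.coprime_primes hq hp).mpr (by omega)
    rw [(jacobiSym.eq_one_or_neg_one hcop).resolve_left hq1]
    norm_num

/-- Assuming GRH, there is a constant `c > 0` such that for infinitely many primes `p`,
every prime `q ≤ c log p log log p` (logs base 2) satisfies `(q/p) = 1`; i.e. the least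
quadratic nonresidue mod `p` exceeds `c log p log log p`. -/
theorem statement16 (hGRH : GRH) :
    ∃ c : ℝ, 0 < c ∧
      {p : ℕ | ∃ hp : p.Prime, ∀ q : ℕ, q.Prime →
        (q : ℝ) ≤ c * Real.logb 2 p * Real.logb 2 (Real.logb 2 p) →
          @legendreSym p ⟨hp⟩ (q : ℤ) = 1}.Infinite := by
  refine ⟨1 / 1440, by norm_num, Set.infinite_of_forall_exists_gt fun a ↦ ?_⟩
  have hx : Filter.Tendsto (fun m : ℕ ↦ ⌊(m : ℝ) * Real.log m / 32⌋₊) Filter.atTop Filter.atTop :=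
    tendsto_nat_floor_atTop.comp ((tendsto_natCast_atTop_atTop.atTop_mul_atTop₀
      (Real.tendsto_log_atTop.comp tendsto_natCast_atTop_atTop)).atTop_div_const (by norm_num))
  obtain ⟨m, ⟨p, hp, hXp, hpe, hq⟩, ham, hm⟩ := (hGRH.frequently_exists_prime.and_eventually
    ((hx.eventually_ge_atTop a).and (Filter.eventually_ge_atTop 15))).exists
  refine ⟨p, ⟨hp, fun q hqp hqle ↦ ?_⟩, ham.trans_lt hXp⟩
  have : Fact p.Prime := ⟨hp⟩
  rw [jacobiSym.legendreSym.to_jacobiSym]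
  refine hq q hqp (Nat.le_floor (hqle.trans ?_))
  have hm' : (15 : ℝ) ≤ m := by exact_mod_cast hm
  have hp2 : (2 : ℝ) ≤ p := by exact_mod_cast hp.two_le
  have hlog2 := Real.log_two_gt_d9
  have h1 : 1 ≤ Real.logb 2 p := by
    rw [Real.le_logb_iff_rpow_le one_lt_two (by linarith), Real.rpow_one]
    exact hp2
  have h2 : Real.logb 2 p ≤ 15 * m := by
    rw [Real.logb, div_le_iff₀ (by linarith)]
    have := (Real.log_lt_iff_lt_exp (by linarith)).mpr hpe
    nlinarith
  have h3 : 0 ≤ Real.logb 2 (Real.logb 2 p) := Real.logb_nonneg one_lt_two h1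
  have hlm : 0 ≤ Real.log m := Real.log_natCast_nonneg m
  have h4 : Real.logb 2 (Real.logb 2 p) ≤ 3 * Real.log m := by
    rw [Real.logb, div_le_iff₀ (by linarith)]
    have h5 : Real.log (Real.logb 2 p) ≤ Real.log (m * m) :=
      Real.log_le_log (by linarith) (h2.trans (by nlinarith))
    rw [Real.log_mul (by positivity) (by positivity)] at h5
    nlinarith
  calc _ ≤ 1 / 1440 * (15 * m) * (3 * Real.log m) := by gcongr
    _ = _ := by ring
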